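/- arXiv:2311.08912 — 2 statements merged into one kernel-verified Lean document; each statement's English description precedes it below -/
import Mathlib

section
/- Let m > 0, g > 0, and let f > 3·(m²g/4)^(1/3) (i.e. the energy −f lies below the first critical value E₁ = −3(m²g/4)^(1/3) of the frozen Hill potential with repulsive centrifugal correction). For each a ∈ [0, m] let S_a = {(z,w) ∈ ℝ² : w²/8 + f·z² − g·z⁶ ≤ a} and let I(a) denote the Lebesgue measure (area) of the connected component of S_a containing the origin. Then I is continuous and strictly increasing on [0, m], and the function φ : [0, I(m)] → ℝ defined by φ(x) = I(m − I⁻¹(x)) is strictly decreasing and convex. (This expresses that the bounded component of the Levi-Civita regularized energy hypersurface {|w|²/8 + f(z₁²+z₂²) − g(z₁⁶+z₂⁶) = m} bounds a concave toric domain.) -/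
open MeasureTheory Set

lemma P_strict {g f σ s t : ℝ} (hg : 0 < g) (h3 : 3 * g * σ ^ 2 = f) (hs : 0 ≤ s) (hst : s < t)
    (ht : t ≤ σ) : f * s - g * s ^ 3 < f * t - g * t ^ 3 := by
  have h1 : t ^ 2 + t * s + s ^ 2 < 3 * σ ^ 2 := by nlinarith
  have h2 : 0 < (t - s) * (g * (3 * σ ^ 2 - (t ^ 2 + t * s + s ^ 2))) :=
    mul_pos (by linarith) (mul_pos hg (by linarith))
  subst h3
  nlinarith

lemma P_mono {g f σ s t : ℝ} (hg : 0 < g) (h3 : 3 * g * σ ^ 2 = f) (hs : 0 ≤ s) (hst : s ≤ t)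
    (ht : t ≤ σ) : f * s - g * s ^ 3 ≤ f * t - g * t ^ 3 := by
  rcases hst.eq_or_lt with h | h
  · rw [h]
  · exact (P_strict hg h3 hs h ht).le

lemma P_le_imp {g f σ s t : ℝ} (hg : 0 < g) (h3 : 3 * g * σ ^ 2 = f) (hs : s ≤ σ) (ht : 0 ≤ t)
    (h : f * s - g * s ^ 3 ≤ f * t - g * t ^ 3) : s ≤ t := by
  by_contra! hc
  exact absurd (P_strict hg h3 ht hc hs) (not_lt.2 h)

lemma ex_sigma (m g f : ℝ) (hm : 0 < m) (hg : 0 < g)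
    (hf : 3 * (m ^ 2 * g / 4) ^ ((1 : ℝ) / 3) < f) :
    ∃ σ : ℝ, 0 < σ ∧ 3 * g * σ ^ 2 = f ∧ m < f * σ - g * σ ^ 3 := by
  set r := (m ^ 2 * g / 4) ^ ((1 : ℝ) / 3) with hr
  have hr0 : 0 < r := by positivity
  have hr3 : r ^ 3 = m ^ 2 * g / 4 := by
    rw [hr, ← Real.rpow_natCast, ← Real.rpow_mul (by positivity)]
    norm_num
  have hf0 : 0 < f := by linarith
  have hf3 : 27 * (m ^ 2 * g / 4) < f ^ 3 := by
    rw [← hr3]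
    have := pow_lt_pow_left₀ hf (by positivity) (n := 3) (by norm_num)
    nlinarith
  refine ⟨Real.sqrt (f / (3 * g)), by positivity, ?_, ?_⟩
  · rw [Real.sq_sqrt (by positivity)]; field_simp
  · set σ := Real.sqrt (f / (3 * g)) with hσ
    have hσ0 : 0 < σ := by positivity
    have h3 : 3 * g * σ ^ 2 = f := by
      rw [hσ, Real.sq_sqrt (by positivity)]; field_simp
    have e : f * σ - g * σ ^ 3 = 2 * g * σ ^ 3 := by rw [← h3]; ring
    rw [e]
    have h4 : m ^ 2 < (2 * g * σ ^ 3) ^ 2 := by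
      rw [← h3] at hf3
      have : g * m ^ 2 < g * (2 * g * σ ^ 3) ^ 2 := by nlinarith
      exact lt_of_mul_lt_mul_left this hg.le
    exact lt_of_pow_lt_pow_left₀ 2 (by positivity) h4

lemma ex_S (m g f σ : ℝ) (hm : 0 < m) (hg : 0 < g) (hσ : 0 < σ) (h3 : 3 * g * σ ^ 2 = f)
    (hM : m < f * σ - g * σ ^ 3) :
    ∃ S : ℝ → ℝ, Continuous S ∧ (∀ b, 0 ≤ S b) ∧ (∀ b, S b < σ) ∧
      (∀ b ∈ Icc 0 m, f * S b - g * S b ^ 3 = b) ∧ (∀ b ≤ 0, S b = 0) := by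
  have hex : ∀ b : Icc (0 : ℝ) m, ∃ s : ℝ, 0 ≤ s ∧ s < σ ∧ f * s - g * s ^ 3 = b := by
    rintro ⟨b, hb0, hbm⟩
    have hc : ContinuousOn (fun s : ℝ => f * s - g * s ^ 3) (Icc 0 σ) := by fun_prop
    obtain ⟨s, hs, hs'⟩ := intermediate_value_Icc hσ.le hc
      (show b ∈ Icc _ _ from ⟨by simpa using hb0, by linarith⟩)
    refine ⟨s, hs.1, lt_of_le_of_ne hs.2 ?_, hs'⟩
    rintro rfl
    simp only at hs'
    linarith
  choose s hs0 hsσ hsP using hex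
  have hmono : ∀ b b', b ≤ b' → s b ≤ s b' := fun b b' h =>
    P_le_imp hg h3 (hsσ b).le (hs0 b') (by rw [hsP, hsP]; exact h)
  set q : ℝ := s ⟨m, hm.le, le_rfl⟩ with hq
  have hq0 : 0 ≤ q := hs0 _
  have hqσ : q < σ := hsσ _
  have hlam : 0 < f - 3 * g * q ^ 2 := by
    rw [← h3]
    have : q ^ 2 < σ ^ 2 := by nlinarith
    nlinarith
  have hlip : ∀ b b', b ≤ b' → (f - 3 * g * q ^ 2) * (s b' - s b) ≤ (b' : ℝ) - b := by
    intro b b' h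
    have h1 := hmono _ _ h
    have h2 : s b' ≤ q := hmono _ _ b'.2.2
    have h0 := hs0 b
    rw [← hsP b, ← hsP b']
    have h4 : s b' ^ 2 + s b' * s b + s b ^ 2 ≤ 3 * q ^ 2 := by nlinarith
    have h5 : 0 ≤ (s b' - s b) * (g * (3 * q ^ 2 - (s b' ^ 2 + s b' * s b + s b ^ 2))) :=
      mul_nonneg (by linarith) (mul_nonneg hg.le (by linarith))
    nlinarith
  have hcont : Continuous s := by
    rw [Metric.continuous_iff]
    intro b ε hε
    refine ⟨(f - 3 * g * q ^ 2) * ε, by positivity, fun a ha => ?_⟩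
    rw [Subtype.dist_eq, Real.dist_eq] at ha
    rw [Real.dist_eq]
    refine lt_of_mul_lt_mul_left (lt_of_le_of_lt ?_ ha) hlam.le
    rcases le_total a b with h | h
    · rw [abs_sub_comm, abs_sub_comm (a : ℝ), abs_of_nonneg (by linarith [hmono _ _ h]),
        abs_of_nonneg (sub_nonneg.2 (show (a : ℝ) ≤ b from h))]
      exact hlip _ _ h
    · rw [abs_of_nonneg (by linarith [hmono _ _ h]), abs_of_nonneg (sub_nonneg.2 (show (b : ℝ) ≤ a from h))]
      exact hlip _ _ h
  refine ⟨fun b => s (projIcc 0 m hm.le b), hcont.comp continuous_projIcc, fun b => hs0 _,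
    fun b => hsσ _, ?_, ?_⟩
  · intro b hb
    simp only
    rw [projIcc_of_mem _ hb, hsP]
  · intro b hb
    simp only
    rw [projIcc_of_le_left _ hb]
    refine le_antisymm (P_le_imp hg h3 (hsσ _).le le_rfl ?_) (hs0 _)
    rw [hsP]; simp

lemma S_convex (m g f σ : ℝ) (hg : 0 < g) (h3 : 3 * g * σ ^ 2 = f)
    (S : ℝ → ℝ) (hS0 : ∀ b, 0 ≤ S b) (hSσ : ∀ b, S b < σ)
    (hSP : ∀ b ∈ Icc 0 m, f * S b - g * S b ^ 3 = b) : ConvexOn ℝ (Icc 0 m) S := by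
  refine ⟨convex_Icc 0 m, fun x hx y hy p q hp hq hpq => ?_⟩
  simp only [smul_eq_mul]
  have hz := convex_Icc 0 m hx hy hp hq hpq
  simp only [smul_eq_mul] at hz
  refine P_le_imp hg h3 (hSσ _).le
    (add_nonneg (mul_nonneg hp (hS0 x)) (mul_nonneg hq (hS0 y))) ?_
  rw [hSP _ hz]
  have hc := (convexOn_pow 3).2 (show S x ∈ Ici (0:ℝ) from hS0 x) (show S y ∈ Ici (0:ℝ) from hS0 y) hp hq hpq
  simp only [smul_eq_mul] at hc
  have := hSP x hx
  have := hSP y hy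
  nlinarith [mul_le_mul_of_nonneg_left hc hg.le]

lemma G_convex (m g f σ : ℝ) (hg : 0 < g) (hσ : 0 < σ) (h3 : 3 * g * σ ^ 2 = f)
    (S : ℝ → ℝ) (hS0 : ∀ b, 0 ≤ S b) (hSσ : ∀ b, S b < σ)
    (hSP : ∀ b ∈ Icc 0 m, f * S b - g * S b ^ 3 = b) :
    ConvexOn ℝ (Icc 0 m) (fun b => √b * √(S b)) := by
  have hSc := S_convex m g f σ hg h3 S hS0 hSσ hSP
  have hDpos : ∀ b, 0 < f - g * S b ^ 2 := by
    intro b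
    have : S b ^ 2 < σ ^ 2 := by nlinarith [hS0 b, hSσ b]
    nlinarith [mul_pos hg (pow_pos hσ 2)]
  have hS2 : ConvexOn ℝ (Icc 0 m) (fun b => S b ^ 2) := hSc.pow (fun b _ => hS0 b) 2
  have hr : ConcaveOn ℝ (Icc 0 m) (fun b => √(f - g * S b ^ 2)) := by
    refine ⟨convex_Icc 0 m, fun x hx y hy p q hp hq hpq => ?_⟩
    have h1 := hS2.2 hx hy hp hq hpq
    have h2 := Real.strictConcaveOn_sqrt.concaveOn.2 (show f - g * S x ^ 2 ∈ Ici (0:ℝ) from (hDpos x).le)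
      (show f - g * S y ^ 2 ∈ Ici (0:ℝ) from (hDpos y).le) hp hq hpq
    refine h2.trans (Real.sqrt_le_sqrt ?_)
    simp only [smul_eq_mul] at h1 ⊢
    have : q = 1 - p := by linarith
    subst this
    nlinarith [mul_le_mul_of_nonneg_left h1 hg.le]
  have hk : ConvexOn ℝ (Icc 0 m) (fun b => (√(f - g * S b ^ 2))⁻¹) := by
    refine ⟨convex_Icc 0 m, fun x hx y hy p q hp hq hpq => ?_⟩
    have h1 := hr.2 hx hy hp hq hpq
    have hx0 := Real.sqrt_pos.2 (hDpos x)
    have hy0 := Real.sqrt_pos.2 (hDpos y)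
    have h2 := (convexOn_zpow (𝕜 := ℝ) (-1)).2 (show _ ∈ Ioi (0:ℝ) from hx0)
      (show _ ∈ Ioi (0:ℝ) from hy0) hp hq hpq
    simp only [zpow_neg_one] at h2
    refine le_trans (inv_anti₀ ?_ h1) h2
    exact (convex_Ioi (0:ℝ)) hx0 hy0 hp hq hpq
  have hSm : MonotoneOn S (Icc 0 m) := fun x hx y hy hxy =>
    P_le_imp hg h3 (hSσ _).le (hS0 _) (by rw [hSP _ hx, hSP _ hy]; exact hxy)
  have hkm : MonotoneOn (fun b => (√(f - g * S b ^ 2))⁻¹) (Icc 0 m) := by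
    intro x hx y hy hxy
    refine inv_anti₀ (Real.sqrt_pos.2 (hDpos y)) (Real.sqrt_le_sqrt ?_)
    have := pow_le_pow_left₀ (hS0 x) (hSm hx hy hxy) 2
    nlinarith
  have hprod := (convexOn_id (𝕜 := ℝ) (convex_Icc 0 m)).mul hk (fun b hb => hb.1)
    (fun b hb => by positivity) (monotoneOn_id.monovaryOn hkm)
  refine hprod.congr ?_
  intro b hb
  simp only [Pi.mul_apply, id]
  have e : b = S b * (f - g * S b ^ 2) := by linear_combination -hSP b hb
  have hD := Real.sqrt_pos.2 (hDpos b)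
  have hDs := Real.mul_self_sqrt (hDpos b).le
  have hSs := Real.mul_self_sqrt (hS0 b)
  have e2 : √b = √(S b) * √(f - g * S b ^ 2) := by
    rw [← Real.sqrt_mul (hS0 b), ← e]
  rw [e2, ← div_eq_mul_inv, div_eq_iff hD.ne']
  calc b = S b * (f - g * S b ^ 2) := e
    _ = (√(S b) * √(S b)) * (√(f - g * S b ^ 2) * √(f - g * S b ^ 2)) := by rw [hDs, hSs]
    _ = _ := by ring

lemma comp_eq (m g f σ a : ℝ) (hg : 0 < g) (hσ : 0 < σ) (h3 : 3 * g * σ ^ 2 = f)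
    (hM : m < f * σ - g * σ ^ 3) (ha : a ∈ Icc 0 m) :
    connectedComponentIn {p : ℝ × ℝ | p.2 ^ 2 / 8 + f * p.1 ^ 2 - g * p.1 ^ 6 ≤ a} (0, 0)
      = {p : ℝ × ℝ | p.1 ^ 2 ≤ σ ∧ p.2 ^ 2 / 8 + f * p.1 ^ 2 - g * p.1 ^ 6 ≤ a} := by
  have h0 : ((0, 0) : ℝ × ℝ) ∈ {p : ℝ × ℝ | p.2 ^ 2 / 8 + f * p.1 ^ 2 - g * p.1 ^ 6 ≤ a} := by
    simpa using ha.1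
  apply Subset.antisymm
  · intro p hp
    have hp2 := connectedComponentIn_subset _ _ hp
    refine ⟨?_, hp2⟩
    by_contra! hc
    have hpre := (isPreconnected_connectedComponentIn
      (F := {p : ℝ × ℝ | p.2 ^ 2 / 8 + f * p.1 ^ 2 - g * p.1 ^ 6 ≤ a}) (x := (0, 0)))
    have h1 := hpre.intermediate_value (mem_connectedComponentIn h0) hp
      (f := fun p : ℝ × ℝ => p.1 ^ 2) (by fun_prop)
    obtain ⟨r, hr, hr'⟩ := h1 (show σ ∈ Icc _ _ from ⟨by simpa using hσ.le, hc.le⟩)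
    have h2 := connectedComponentIn_subset _ _ hr
    simp only [mem_ofPred_eq] at h2 hr'
    have e : r.1 ^ 6 = σ ^ 3 := by rw [← hr']; ring
    rw [e, hr'] at h2
    nlinarith [sq_nonneg r.2, ha.2]
  · apply IsPreconnected.subset_connectedComponentIn
    · have hst : StarConvex ℝ ((0, 0) : ℝ × ℝ)
        {p : ℝ × ℝ | p.1 ^ 2 ≤ σ ∧ p.2 ^ 2 / 8 + f * p.1 ^ 2 - g * p.1 ^ 6 ≤ a} := by
        rintro ⟨z, w⟩ ⟨hz, hK⟩ p q hp hq hpq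
        simp only [Prod.smul_mk, smul_eq_mul, mul_zero, Prod.mk_add_mk, zero_add, mem_ofPred_eq] at *
        have hq1 : q ≤ 1 := by linarith
        have hq2 : q ^ 2 ≤ 1 := by nlinarith
        have hzz : (q * z) ^ 2 ≤ z ^ 2 := by rw [mul_pow]; nlinarith [sq_nonneg z]
        have hww : (q * w) ^ 2 ≤ w ^ 2 := by rw [mul_pow]; nlinarith [sq_nonneg w]
        refine ⟨hzz.trans hz, ?_⟩
        have := P_mono hg h3 (sq_nonneg (q * z)) hzz hz
        have e1 : (q * z) ^ 6 = ((q * z) ^ 2) ^ 3 := by ring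
        have e2 : z ^ 6 = (z ^ 2) ^ 3 := by ring
        rw [e1]; rw [e2] at hK
        linarith
      refine (hst.isPathConnected ?_).isConnected.isPreconnected
      show (0 : ℝ) ^ 2 ≤ σ ∧ _
      exact ⟨by simpa using hσ.le, by simpa using ha.1⟩
    · show (0 : ℝ) ^ 2 ≤ σ ∧ _
      exact ⟨by simpa using hσ.le, by simpa using ha.1⟩
    · rintro p ⟨_, hp⟩
      exact hp

lemma section_vol (m g f σ a w : ℝ) (hg : 0 < g) (h3 : 3 * g * σ ^ 2 = f)
    (S : ℝ → ℝ) (hS0 : ∀ b, 0 ≤ S b) (hSσ : ∀ b, S b < σ)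
    (hSP : ∀ b ∈ Icc 0 m, f * S b - g * S b ^ 3 = b) (hSn : ∀ b ≤ 0, S b = 0)
    (ha : a ∈ Icc 0 m) :
    volume ((fun z : ℝ => (z, w)) ⁻¹'
      {p : ℝ × ℝ | p.1 ^ 2 ≤ σ ∧ p.2 ^ 2 / 8 + f * p.1 ^ 2 - g * p.1 ^ 6 ≤ a})
      = ENNReal.ofReal (2 * √(S (a - w ^ 2 / 8))) := by
  rcases lt_or_ge (a - w ^ 2 / 8) 0 with hb | hb
  · rw [hSn _ hb.le]
    simp only [Real.sqrt_zero, mul_zero, ENNReal.ofReal_zero]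
    convert measure_empty (μ := (volume : Measure ℝ))
    ext z
    simp only [mem_preimage, mem_ofPred_eq, mem_empty_iff_false, iff_false, not_and, not_le]
    intro hz
    have := P_mono hg h3 le_rfl (sq_nonneg z) hz
    have e2 : z ^ 6 = (z ^ 2) ^ 3 := by ring
    rw [e2]; linarith
  · have hbm : a - w ^ 2 / 8 ∈ Icc 0 m := ⟨hb, by nlinarith [ha.2, sq_nonneg w]⟩
    set b := a - w ^ 2 / 8 with hbdef
    have : ((fun z : ℝ => (z, w)) ⁻¹'
      {p : ℝ × ℝ | p.1 ^ 2 ≤ σ ∧ p.2 ^ 2 / 8 + f * p.1 ^ 2 - g * p.1 ^ 6 ≤ a})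
      = Icc (-√(S b)) (√(S b)) := by
      ext z
      have e1 : |z| ≤ √(S b) ↔ z ^ 2 ≤ S b := by
        rw [← Real.sqrt_sq_eq_abs, Real.sqrt_le_sqrt_iff (hS0 b)]
      rw [mem_Icc, ← abs_le, e1]
      have e2 : z ^ 6 = (z ^ 2) ^ 3 := by ring
      simp only [mem_preimage, mem_ofPred_eq]
      rw [e2]
      constructor
      · rintro ⟨h1, h2⟩
        refine P_le_imp hg h3 h1 (hS0 b) ?_
        rw [hSP b hbm]; linarith
      · intro h
        refine ⟨h.trans (hSσ b).le, ?_⟩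
        have := P_mono hg h3 (sq_nonneg z) h (hSσ b).le
        rw [hSP b hbm] at this
        linarith
    rw [this, Real.volume_Icc]
    congr 1; ring

lemma phi_part (m : ℝ) (hm : 0 < m) (I : ℝ → ℝ) (hI0 : I 0 = 0)
    (hc : ContinuousOn I (Icc 0 m)) (hs : StrictMonoOn I (Icc 0 m))
    (hcv : ConvexOn ℝ (Icc 0 m) I) (φ : ℝ → ℝ)
    (hφ : ∀ a ∈ Icc (0 : ℝ) m, φ (I a) = I (m - a)) :
    StrictAntiOn φ (Icc 0 (I m)) ∧ ConvexOn ℝ (Icc 0 (I m)) φ := by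
  have hsurj : ∀ x ∈ Icc 0 (I m), ∃ a ∈ Icc 0 m, I a = x := by
    intro x hx
    have := intermediate_value_Icc hm.le hc
    rw [hI0] at this
    exact this hx
  have hsub : ∀ a ∈ Icc 0 m, m - a ∈ Icc 0 m := fun a ha => ⟨by linarith [ha.2], by linarith [ha.1]⟩
  constructor
  · intro x hx y hy hxy
    obtain ⟨a, ha, rfl⟩ := hsurj x hx
    obtain ⟨b, hb, rfl⟩ := hsurj y hy
    rw [hφ a ha, hφ b hb]
    have := (hs.lt_iff_lt ha hb).1 hxy
    exact hs (hsub b hb) (hsub a ha) (by linarith)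
  · refine ⟨convex_Icc _ _, fun x hx y hy p q hp hq hpq => ?_⟩
    obtain ⟨c, hc', hce⟩ := hsurj _ (convex_Icc _ _ hx hy hp hq hpq)
    obtain ⟨a, ha, rfl⟩ := hsurj x hx
    obtain ⟨b, hb, rfl⟩ := hsurj y hy
    rw [← hce, hφ a ha, hφ b hb, hφ c hc']
    have h1 := hcv.2 ha hb hp hq hpq
    rw [← hce] at h1
    have h2 := (hs.le_iff_le (convex_Icc _ _ ha hb hp hq hpq) hc').1 h1
    have h3 := hcv.2 (hsub a ha) (hsub b hb) hp hq hpq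
    refine le_trans (hs.monotoneOn (hsub c hc')
      (convex_Icc _ _ (hsub a ha) (hsub b hb) hp hq hpq) ?_) h3
    simp only [smul_eq_mul] at h2 ⊢
    have : q = 1 - p := by linarith
    subst this
    linarith

lemma I_formula (m g f σ a : ℝ) (hg : 0 < g) (hσ : 0 < σ) (h3 : 3 * g * σ ^ 2 = f)
    (hM : m < f * σ - g * σ ^ 3)
    (S : ℝ → ℝ) (hSc : Continuous S) (hS0 : ∀ b, 0 ≤ S b) (hSσ : ∀ b, S b < σ)
    (hSP : ∀ b ∈ Icc 0 m, f * S b - g * S b ^ 3 = b) (hSn : ∀ b ≤ 0, S b = 0)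
    (ha : a ∈ Icc 0 m) :
    (volume (connectedComponentIn
        {p : ℝ × ℝ | p.2 ^ 2 / 8 + f * p.1 ^ 2 - g * p.1 ^ 6 ≤ a} (0, 0))).toReal
      = ∫ y : ℝ, 2 * (√a * √(S (a * (1 - y ^ 2 / 8)))) := by
  rw [comp_eq m g f σ a hg hσ h3 hM ha]
  have hmeas : MeasurableSet
      {p : ℝ × ℝ | p.1 ^ 2 ≤ σ ∧ p.2 ^ 2 / 8 + f * p.1 ^ 2 - g * p.1 ^ 6 ≤ a} := by
    apply IsClosed.measurableSet
    have c1 : IsClosed {p : ℝ × ℝ | p.1 ^ 2 ≤ σ} := isClosed_le (by fun_prop) (by fun_prop)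
    have c2 : IsClosed {p : ℝ × ℝ | p.2 ^ 2 / 8 + f * p.1 ^ 2 - g * p.1 ^ 6 ≤ a} :=
      isClosed_le (by fun_prop) (by fun_prop)
    exact c1.inter c2
  rw [Measure.volume_eq_prod, Measure.prod_apply_symm hmeas]
  simp_rw [section_vol m g f σ a _ hg h3 S hS0 hSσ hSP hSn ha]
  rw [← integral_eq_lintegral_of_nonneg_ae (Filter.Eventually.of_forall fun w => by positivity)
    (by fun_prop : Continuous fun w : ℝ => 2 * √(S (a - w ^ 2 / 8))).aestronglyMeasurable]
  change ∫ w : ℝ, 2 * √(S (a - w ^ 2 / 8)) = _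
  rcases ha.1.eq_or_lt with h0 | h0
  · rw [← h0]
    have : ∀ w : ℝ, S (0 - w ^ 2 / 8) = 0 := fun w => hSn _ (by nlinarith [sq_nonneg w])
    simp only [this]
    simp
  · have h := Measure.integral_comp_mul_left (fun w : ℝ => 2 * √(S (a - w ^ 2 / 8))) (√a)
    have hsq : 0 < √a := Real.sqrt_pos.2 h0
    rw [abs_of_pos (by positivity), smul_eq_mul] at h
    have e : ∀ y : ℝ, a - (√a * y) ^ 2 / 8 = a * (1 - y ^ 2 / 8) := by
      intro y
      rw [mul_pow, Real.sq_sqrt h0.le]; ring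
    simp only [e] at h
    have e2 : ∀ y : ℝ, 2 * (√a * √(S (a * (1 - y ^ 2 / 8))))
        = √a * (2 * √(S (a * (1 - y ^ 2 / 8)))) := fun y => by ring
    simp_rw [e2]
    rw [integral_const_mul (√a), h, ← mul_assoc, mul_inv_cancel₀ hsq.ne', one_mul]

theorem stmt_0 (m g f : ℝ) (hm : 0 < m) (hg : 0 < g)
    (hf : 3 * (m ^ 2 * g / 4) ^ ((1 : ℝ) / 3) < f)
    (I : ℝ → ℝ)
    (hI : ∀ a : ℝ, I a =
      (volume (connectedComponentIn
        {p : ℝ × ℝ | p.2 ^ 2 / 8 + f * p.1 ^ 2 - g * p.1 ^ 6 ≤ a} (0, 0))).toReal) :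
    ContinuousOn I (Icc 0 m) ∧ StrictMonoOn I (Icc 0 m) ∧
    ∀ φ : ℝ → ℝ, (∀ a ∈ Icc (0 : ℝ) m, φ (I a) = I (m - a)) →
      StrictAntiOn φ (Icc 0 (I m)) ∧ ConvexOn ℝ (Icc 0 (I m)) φ := by
  obtain ⟨σ, hσ, h3, hM⟩ := ex_sigma m g f hm hg hf
  obtain ⟨S, hSc, hS0, hSσ, hSP, hSn⟩ := ex_S m g f σ hm hg hσ h3 hM
  have hIf : ∀ a ∈ Icc 0 m, I a = ∫ y : ℝ, 2 * (√a * √(S (a * (1 - y ^ 2 / 8)))) :=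
    fun a ha => (hI a).trans (I_formula m g f σ a hg hσ h3 hM S hSc hS0 hSσ hSP hSn ha)
  have hzero : ∀ a : ℝ, 0 ≤ a → ∀ y : ℝ, y ∉ Icc (-3 : ℝ) 3 →
      2 * (√a * √(S (a * (1 - y ^ 2 / 8)))) = 0 := by
    intro a ha y hy
    have : 9 < y ^ 2 := by
      by_contra! hc
      exact hy ⟨by nlinarith, by nlinarith⟩
    rw [hSn _ (mul_nonpos_of_nonneg_of_nonpos ha (by linarith))]
    simp
  have hcs : ∀ a : ℝ, 0 ≤ a →
      HasCompactSupport (fun y : ℝ => 2 * (√a * √(S (a * (1 - y ^ 2 / 8))))) :=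
    fun a ha => HasCompactSupport.intro isCompact_Icc (hzero a ha)
  have hcy : ∀ a : ℝ, Continuous (fun y : ℝ => 2 * (√a * √(S (a * (1 - y ^ 2 / 8))))) := by
    intro a; fun_prop
  have hInteg : ∀ a : ℝ, 0 ≤ a →
      Integrable (fun y : ℝ => 2 * (√a * √(S (a * (1 - y ^ 2 / 8))))) :=
    fun a ha => (hcy a).integrable_of_hasCompactSupport (hcs a ha)
  have hI0 : I 0 = 0 := by
    rw [hIf 0 ⟨le_rfl, hm.le⟩]; simp
  have hpos : ∀ a ∈ Icc 0 m, 0 < a → 0 < I a := by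
    intro a ha h0
    rw [hIf a ha]
    refine (hcy a).integral_pos_of_hasCompactSupport_nonneg_nonzero (x := 0) (hcs a ha.1)
      (fun y => by positivity) ?_
    have hSa : 0 < S a := by
      refine lt_of_le_of_ne (hS0 a) fun h => ?_
      have := hSP a ha
      rw [← h] at this
      simp at this
      linarith
    simp only [ne_eq, OfNat.ofNat_ne_zero, not_false_eq_true, zero_pow, zero_div, sub_zero, mul_one]
    positivity
  have hcont : ContinuousOn I (Icc 0 m) := by
    have h1 : Continuous fun a : ℝ =>
        ∫ y in Icc (-3 : ℝ) 3, 2 * (√a * √(S (a * (1 - y ^ 2 / 8)))) := by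
      refine continuous_parametric_integral_of_continuous ?_ isCompact_Icc
      simp only [Function.uncurry_def]
      fun_prop
    refine h1.continuousOn.congr fun a ha => ?_
    rw [hIf a ha]
    exact (setIntegral_eq_integral_of_forall_compl_eq_zero (hzero a ha.1)).symm
  have hG := G_convex m g f σ hg hσ h3 S hS0 hSσ hSP
  have hcv : ConvexOn ℝ (Icc 0 m) I := by
    refine ⟨convex_Icc 0 m, fun a ha b hb p q hp hq hpq => ?_⟩
    have hab := convex_Icc 0 m ha hb hp hq hpq
    rw [hIf a ha, hIf b hb, hIf _ hab]
    simp only [smul_eq_mul] at hab ⊢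
    rw [← integral_const_mul, ← integral_const_mul,
      ← integral_add ((hInteg a ha.1).const_mul p) ((hInteg b hb.1).const_mul q)]
    refine integral_mono (hInteg _ hab.1)
      (((hInteg a ha.1).const_mul p).add ((hInteg b hb.1).const_mul q)) fun y => ?_
    simp only
    set c := 1 - y ^ 2 / 8 with hc
    rcases le_or_gt c 0 with h0 | h0
    · rw [hSn _ (mul_nonpos_of_nonneg_of_nonpos ha.1 h0),
        hSn _ (mul_nonpos_of_nonneg_of_nonpos hb.1 h0),
        hSn _ (mul_nonpos_of_nonneg_of_nonpos hab.1 h0)]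
      simp
    · have hc1 : c ≤ 1 := by nlinarith [sq_nonneg y]
      have hmem : ∀ x ∈ Icc 0 m, x * c ∈ Icc 0 m := fun x hx =>
        ⟨mul_nonneg hx.1 h0.le, by nlinarith [hx.1, hx.2]⟩
      have h := hG.2 (hmem a ha) (hmem b hb) hp hq hpq
      simp only [smul_eq_mul] at h
      rw [show p * (a * c) + q * (b * c) = (p * a + q * b) * c by ring,
        Real.sqrt_mul ha.1, Real.sqrt_mul hb.1, Real.sqrt_mul hab.1] at h
      have hsc : 0 < √c := Real.sqrt_pos.2 h0
      refine le_of_mul_le_mul_left ?_ hsc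
      linarith
  have hmono : StrictMonoOn I (Icc 0 m) := by
    intro a ha b hb hab
    have hb0 : 0 < b := lt_of_le_of_lt ha.1 hab
    have h := hcv.2 (show (0:ℝ) ∈ Icc 0 m from ⟨le_rfl, hm.le⟩) hb
      (show 0 ≤ 1 - a / b by rw [sub_nonneg, div_le_one hb0]; exact hab.le)
      (show 0 ≤ a / b from div_nonneg ha.1 hb0.le) (by ring)
    simp only [smul_eq_mul, mul_zero, zero_add, hI0] at h
    rw [div_mul_cancel₀ _ hb0.ne'] at h
    have h1 : a / b < 1 := (div_lt_one hb0).2 hab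
    have := hpos b hb hb0
    nlinarith
  exact ⟨hcont, hmono, fun φ hφ => phi_part m hm I hI0 hcont hmono hcv φ hφ⟩
end

section
/- Let m > 0, g < 0, and f > 0. For each a ∈ [0, m] let S_a = {(z,w) ∈ ℝ² : w²/8 + f·z² − g·z⁶ ≤ a} (a compact set since −g > 0) and let I(a) denote the Lebesgue measure (area) of S_a. Then I is continuous and strictly increasing on [0, m], and the function φ : [0, I(m)] → ℝ defined by φ(x) = I(m − I⁻¹(x)) is strictly decreasing and concave. (This expresses that the Levi-Civita regularized energy hypersurface {|w|²/8 + f(z₁²+z₂²) − g(z₁⁶+z₂⁶) = m} bounds a convex toric domain.) -/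
open MeasureTheory Set

/-- Radial integral over the ray at angle `θ`. -/
noncomputable def hillG (f h θ a : ℝ) : ENNReal :=
  ∫⁻ r in Ioi (0 : ℝ), ENNReal.ofReal r *
    ({r : ℝ | r ^ 2 * (Real.sin θ ^ 2 / 8 + f * Real.cos θ ^ 2) + h * Real.cos θ ^ 6 * r ^ 6 ≤ a}.indicator 1 r)

lemma hill_root (A B a : ℝ) (hA : 0 < A) (hB : 0 ≤ B) (ha : 0 ≤ a) :
    ∃ c : ℝ, 0 ≤ c ∧ c ^ 2 * A + B * c ^ 6 = a := by
  have hc : ContinuousOn (fun c : ℝ => c ^ 2 * A + B * c ^ 6) (Icc 0 (1 + a / A)) := by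
    fun_prop
  have h0 : (0 : ℝ) ≤ 1 + a / A := by positivity
  have := intermediate_value_Icc h0 hc
  have hmem : a ∈ Icc ((0:ℝ) ^ 2 * A + B * 0 ^ 6) ((1 + a / A) ^ 2 * A + B * (1 + a / A) ^ 6) := by
    constructor
    · simpa using ha
    · have h1 : 0 ≤ B * (1 + a / A) ^ 6 := by positivity
      have h2 : (1 + a / A) ^ 2 * A = A + 2 * a + a * (a / A) := by field_simp; ring
      have h3 : 0 ≤ a * (a / A) := by positivity
      nlinarith
  obtain ⟨c, hc, hca⟩ := this hmem
  exact ⟨c, hc.1, hca⟩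

lemma hill_mono (A B c d : ℝ) (hA : 0 < A) (hB : 0 ≤ B) (hc : 0 ≤ c) (hd : 0 ≤ d) :
    c ^ 2 * A + B * c ^ 6 ≤ d ^ 2 * A + B * d ^ 6 ↔ c ≤ d := by
  constructor
  · intro h
    by_contra! hlt
    have h1 : d ^ 2 < c ^ 2 := by gcongr
    have h2 : B * d ^ 6 ≤ B * c ^ 6 := by gcongr
    nlinarith
  · intro h
    gcongr

lemma hill_radial (c : ℝ) (hc : 0 ≤ c) :
    ∫⁻ r in Ioi (0 : ℝ), ENNReal.ofReal r * ((Iic c).indicator 1 r) = ENNReal.ofReal (c ^ 2 / 2) := by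
  have h1 : ∀ r : ℝ, ENNReal.ofReal r * ((Iic c).indicator 1 r) =
      (Iic c).indicator (fun r => ENNReal.ofReal r) r := by
    intro r
    by_cases h : r ∈ Iic c <;> simp [h]
  simp_rw [h1]
  rw [setLIntegral_indicator measurableSet_Iic, inter_comm, Ioi_inter_Iic]
  rw [← ofReal_integral_eq_lintegral_ofReal]
  · rw [← intervalIntegral.integral_of_le hc]
    simp
  · exact (continuous_id.integrableOn_Icc).mono_set Ioc_subset_Icc_self
  · filter_upwards [ae_restrict_mem measurableSet_Ioc] with r hr using hr.1.le

lemma hill_A (f θ : ℝ) (hf : 0 < f) :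
    min (1/8) f ≤ Real.sin θ ^ 2 / 8 + f * Real.cos θ ^ 2 := by
  have h1 := Real.sin_sq_add_cos_sq θ
  have h2 := min_le_left (1/8) f
  have h3 := min_le_right (1/8) f
  nlinarith [sq_nonneg (Real.sin θ), sq_nonneg (Real.cos θ)]

lemma hill_G_eq (f h θ a c : ℝ) (hf : 0 < f) (hh : 0 < h) (hc : 0 ≤ c)
    (hca : c ^ 2 * (Real.sin θ ^ 2 / 8 + f * Real.cos θ ^ 2) + h * Real.cos θ ^ 6 * c ^ 6 = a) :
    hillG f h θ a = ENNReal.ofReal (c ^ 2 / 2) := by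
  have hA : 0 < Real.sin θ ^ 2 / 8 + f * Real.cos θ ^ 2 :=
    lt_of_lt_of_le (lt_min (by norm_num) hf) (hill_A f θ hf)
  have hB : 0 ≤ h * Real.cos θ ^ 6 := by positivity
  rw [← hill_radial c hc, hillG]
  apply setLIntegral_congr_fun measurableSet_Ioi
  intro r hr
  have := hill_mono _ _ r c hA hB (le_of_lt hr) hc
  rw [hca] at this
  simp only [indicator, mem_setOf_eq, mem_Iic, this]

lemma hill_G_spec (f h θ a : ℝ) (hf : 0 < f) (hh : 0 < h) (ha : 0 ≤ a) :
    ∃ c : ℝ, 0 ≤ c ∧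
    c ^ 2 * (Real.sin θ ^ 2 / 8 + f * Real.cos θ ^ 2) + h * Real.cos θ ^ 6 * c ^ 6 = a ∧
    hillG f h θ a = ENNReal.ofReal (c ^ 2 / 2) := by
  have hA : 0 < Real.sin θ ^ 2 / 8 + f * Real.cos θ ^ 2 :=
    lt_of_lt_of_le (lt_min (by norm_num) hf) (hill_A f θ hf)
  have hB : 0 ≤ h * Real.cos θ ^ 6 := by positivity
  obtain ⟨c, hc, hca⟩ := hill_root _ _ a hA hB ha
  exact ⟨c, hc, hca, hill_G_eq f h θ a c hf hh hc hca⟩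

lemma hill_G_meas (f h a : ℝ) : Measurable fun θ => hillG f h θ a := by
  unfold hillG
  apply Measurable.lintegral_prod_right' (f := fun p : ℝ × ℝ => ENNReal.ofReal p.2 *
    ({r : ℝ | r ^ 2 * (Real.sin p.1 ^ 2 / 8 + f * Real.cos p.1 ^ 2) + h * Real.cos p.1 ^ 6 * r ^ 6 ≤ a}.indicator 1 p.2))
  have h1 : Measurable fun p : ℝ × ℝ => ENNReal.ofReal p.2 := by fun_prop
  refine h1.mul ?_
  have hs : MeasurableSet {p : ℝ × ℝ | p.2 ^ 2 * (Real.sin p.1 ^ 2 / 8 + f * Real.cos p.1 ^ 2) + h * Real.cos p.1 ^ 6 * p.2 ^ 6 ≤ a} :=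
    measurableSet_le (by fun_prop) (by fun_prop)
  exact (measurable_one (α := ENNReal)).indicator hs

lemma hill_vol (f h a : ℝ) :
    volume {p : ℝ × ℝ | p.2 ^ 2 / 8 + f * p.1 ^ 2 + h * p.1 ^ 6 ≤ a} =
      ∫⁻ θ in Ioo (-Real.pi) Real.pi, hillG f h θ a := by
  have hs : MeasurableSet {p : ℝ × ℝ | p.2 ^ 2 / 8 + f * p.1 ^ 2 + h * p.1 ^ 6 ≤ a} :=
    measurableSet_le (by fun_prop) (by fun_prop)
  rw [← lintegral_indicator_one hs, ← lintegral_comp_polarCoord_symm, polarCoord_target,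
    Measure.volume_eq_prod, ← Measure.prod_restrict]
  rw [lintegral_prod_symm]
  · unfold hillG
    congr with θ
    congr with r
    rw [smul_eq_mul]
    congr 1
    simp only [indicator, mem_setOf_eq, polarCoord_symm_apply]
    congr 2
    ring
  · apply Measurable.aemeasurable
    simp only [smul_eq_mul]
    have h1 : Measurable fun p : ℝ × ℝ => ENNReal.ofReal p.1 := by fun_prop
    refine h1.mul (((measurable_one (α := ENNReal)).indicator hs).comp (g := _)
      (f := fun p : ℝ × ℝ => polarCoord.symm p) ?_)
    simp only [polarCoord_symm_apply]
    fun_prop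

lemma hill_G_le (f h θ a : ℝ) (hf : 0 < f) (hh : 0 < h) (ha : 0 ≤ a) :
    hillG f h θ a ≤ ENNReal.ofReal (a / (2 * min (1/8) f)) := by
  obtain ⟨c, hc, hca, hG⟩ := hill_G_spec f h θ a hf hh ha
  rw [hG]
  apply ENNReal.ofReal_le_ofReal
  have hm : 0 < min (1/8) f := lt_min (by norm_num) hf
  have h1 := hill_A f θ hf
  rw [le_div_iff₀ (by positivity)]
  have hB : 0 ≤ h * Real.cos θ ^ 6 * c ^ 6 := by positivity
  nlinarith [mul_le_mul_of_nonneg_left h1 (sq_nonneg c)]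

lemma hill_G_lt (f h θ a b : ℝ) (hf : 0 < f) (hh : 0 < h) (ha : 0 ≤ a) (hab : a < b) :
    hillG f h θ a < hillG f h θ b := by
  obtain ⟨c, hc, hca, hG⟩ := hill_G_spec f h θ a hf hh ha
  obtain ⟨d, hd, hdb, hG'⟩ := hill_G_spec f h θ b hf hh (ha.trans hab.le)
  have hA : 0 < Real.sin θ ^ 2 / 8 + f * Real.cos θ ^ 2 :=
    lt_of_lt_of_le (lt_min (by norm_num) hf) (hill_A f θ hf)
  have hB : 0 ≤ h * Real.cos θ ^ 6 := by positivity
  have := hill_mono _ _ d c hA hB hd hc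
  rw [hca, hdb] at this
  have hlt : c < d := by
    by_contra! hle
    exact absurd (this.2 hle) (not_le.2 hab)
  rw [hG, hG', ENNReal.ofReal_lt_ofReal_iff (by nlinarith)]
  gcongr

lemma hill_G_concave (f h θ a b s t : ℝ) (hf : 0 < f) (hh : 0 < h) (ha : 0 ≤ a) (hb : 0 ≤ b)
    (hs : 0 ≤ s) (ht : 0 ≤ t) (hst : s + t = 1) :
    ENNReal.ofReal s * hillG f h θ a + ENNReal.ofReal t * hillG f h θ b
      ≤ hillG f h θ (s * a + t * b) := by
  obtain ⟨c, hc, hca, hG⟩ := hill_G_spec f h θ a hf hh ha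
  obtain ⟨d, hd, hdb, hG'⟩ := hill_G_spec f h θ b hf hh hb
  obtain ⟨e, he, hee, hG''⟩ := hill_G_spec f h θ (s * a + t * b) hf hh (by positivity)
  have hA : 0 < Real.sin θ ^ 2 / 8 + f * Real.cos θ ^ 2 :=
    lt_of_lt_of_le (lt_min (by norm_num) hf) (hill_A f θ hf)
  have hB : 0 ≤ h * Real.cos θ ^ 6 := by positivity
  rw [hG, hG', hG'', ← ENNReal.ofReal_mul hs, ← ENNReal.ofReal_mul ht,
    ← ENNReal.ofReal_add (by positivity) (by positivity)]
  apply ENNReal.ofReal_le_ofReal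
  have hx : 0 ≤ s * c ^ 2 + t * d ^ 2 := by positivity
  have hq := Real.sq_sqrt hx
  have hq0 := Real.sqrt_nonneg (s * c ^ 2 + t * d ^ 2)
  set q := Real.sqrt (s * c ^ 2 + t * d ^ 2)
  have key : q ≤ e := by
    rw [← hill_mono _ _ q e hA hB hq0 he, hee]
    have hconv := (convexOn_pow 3).2 (show c ^ 2 ∈ Ici (0:ℝ) from sq_nonneg c)
      (show d ^ 2 ∈ Ici (0:ℝ) from sq_nonneg d) hs ht hst
    simp only [smul_eq_mul] at hconv
    rw [← hq] at hconv
    have h6 : q ^ 6 ≤ s * c ^ 6 + t * d ^ 6 := by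
      calc q ^ 6 = (q ^ 2) ^ 3 := by ring
        _ ≤ _ := hconv
        _ = _ := by ring
    have := mul_le_mul_of_nonneg_left h6 hB
    rw [hq]
    rw [← hca, ← hdb]
    linarith
  have : q ^ 2 ≤ e ^ 2 := by gcongr
  linarith

theorem stmt_1 (m g f : ℝ) (hm : 0 < m) (hg : g < 0) (hf : 0 < f)
    (I : ℝ → ℝ)
    (hI : ∀ a : ℝ, I a =
      (volume {p : ℝ × ℝ | p.2 ^ 2 / 8 + f * p.1 ^ 2 - g * p.1 ^ 6 ≤ a}).toReal) :
    ContinuousOn I (Icc 0 m) ∧ StrictMonoOn I (Icc 0 m) ∧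
    ∀ φ : ℝ → ℝ, (∀ a ∈ Icc (0 : ℝ) m, φ (I a) = I (m - a)) →
      StrictAntiOn φ (Icc 0 (I m)) ∧ ConcaveOn ℝ (Icc 0 (I m)) φ := by
  obtain ⟨h, hh, rfl⟩ : ∃ h : ℝ, 0 < h ∧ g = -h := ⟨-g, by linarith, by ring⟩
  have hI' : ∀ a, I a = (∫⁻ θ in Ioo (-Real.pi) Real.pi, hillG f h θ a).toReal := by
    intro a
    rw [hI, ← hill_vol]
    simp only [neg_mul, sub_neg_eq_add]
  clear hI
  have hmn : 0 < min (1/8) f := lt_min (by norm_num) hf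
  have hbd : ∀ a, 0 ≤ a → ∫⁻ θ in Ioo (-Real.pi) Real.pi, hillG f h θ a ≤
      ENNReal.ofReal (a / (2 * min (1/8) f) * (2 * Real.pi)) := by
    intro a ha
    calc _ ≤ ∫⁻ θ in Ioo (-Real.pi) Real.pi, ENNReal.ofReal (a / (2 * min (1/8) f)) :=
          lintegral_mono fun θ => hill_G_le f h θ a hf hh ha
      _ = _ := by
        rw [setLIntegral_const, Real.volume_Ioo, ← ENNReal.ofReal_mul (by positivity)]
        congr 2
        ring
  have hfin : ∀ a, 0 ≤ a → ∫⁻ θ in Ioo (-Real.pi) Real.pi, hillG f h θ a ≠ ⊤ :=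
    fun a ha => ne_top_of_le_ne_top ENNReal.ofReal_ne_top (hbd a ha)
  have hnn : ∀ a, 0 ≤ I a := fun a => by rw [hI']; exact ENNReal.toReal_nonneg
  have hle : ∀ a, 0 ≤ a → I a ≤ a / (2 * min (1/8) f) * (2 * Real.pi) := by
    intro a ha
    rw [hI']
    exact ENNReal.toReal_le_of_le_ofReal (by positivity) (hbd a ha)
  have hI0 : I 0 = 0 := le_antisymm (by simpa using hle 0 le_rfl) (hnn 0)
  have hmono : StrictMonoOn I (Ici 0) := by
    intro a ha b hb hab
    rw [hI', hI']
    apply (ENNReal.toReal_lt_toReal (hfin a ha) (hfin b hb)).2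
    apply lintegral_strict_mono
    · simp [Measure.restrict_eq_zero, Real.pi_pos]
    · exact (hill_G_meas f h b).aemeasurable
    · exact hfin a ha
    · exact Filter.Eventually.of_forall fun θ => hill_G_lt f h θ a b hf hh ha hab
  have hconc : ConcaveOn ℝ (Ici 0) I := by
    refine ⟨convex_Ici 0, ?_⟩
    intro a ha b hb s t hs ht hst
    simp only [smul_eq_mul]
    have ha' : 0 ≤ a := ha
    have hb' : 0 ≤ b := hb
    have hc : 0 ≤ s * a + t * b := by positivity
    have key := lintegral_mono (μ := volume.restrict (Ioo (-Real.pi) Real.pi))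
      fun θ => hill_G_concave f h θ a b s t hf hh ha hb hs ht hst
    rw [lintegral_add_left ((hill_G_meas f h a).const_mul _), lintegral_const_mul _ (hill_G_meas f h a),
      lintegral_const_mul _ (hill_G_meas f h b)] at key
    have := ENNReal.toReal_mono (hfin _ hc) key
    rw [ENNReal.toReal_add (ENNReal.mul_ne_top ENNReal.ofReal_ne_top (hfin a ha))
      (ENNReal.mul_ne_top ENNReal.ofReal_ne_top (hfin b hb)), ENNReal.toReal_mul, ENNReal.toReal_mul,
      ENNReal.toReal_ofReal hs, ENNReal.toReal_ofReal ht, ← hI', ← hI', ← hI'] at this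
    exact this
  have hcont : ContinuousOn I (Ici 0) := by
    intro a ha
    rcases eq_or_lt_of_le (show (0:ℝ) ≤ a from ha) with rfl | hpos
    · unfold ContinuousWithinAt
      rw [hI0]
      have ht : Filter.Tendsto (fun a : ℝ => a / (2 * min (1/8) f) * (2 * Real.pi))
          (nhdsWithin 0 (Ici 0)) (nhds 0) := by
        have : Continuous (fun a : ℝ => a / (2 * min (1/8) f) * (2 * Real.pi)) := by fun_prop
        simpa using (this.tendsto 0).mono_left nhdsWithin_le_nhds
      refine tendsto_of_tendsto_of_tendsto_of_le_of_le' tendsto_const_nhds ht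
        (Filter.Eventually.of_forall hnn) ?_
      filter_upwards [self_mem_nhdsWithin] with x hx using hle x hx
    · have h1 : ContinuousOn I (Ioi 0) :=
        (hconc.subset Ioi_subset_Ici_self (convex_Ioi 0)).continuousOn isOpen_Ioi
      exact (h1.continuousAt (Ioi_mem_nhds hpos)).continuousWithinAt
  have hsub : Icc 0 m ⊆ Ici (0:ℝ) := Icc_subset_Ici_self
  refine ⟨hcont.mono hsub, hmono.mono hsub, ?_⟩
  intro φ hφ
  have hsurj : ∀ x ∈ Icc 0 (I m), ∃ a ∈ Icc 0 m, I a = x := by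
    intro x hx
    have := intermediate_value_Icc hm.le (hcont.mono hsub)
    rw [hI0] at this
    exact this hx
  refine ⟨?_, convex_Icc _ _, ?_⟩
  · intro x hx y hy hxy
    obtain ⟨a, ha, rfl⟩ := hsurj x hx
    obtain ⟨b, hb, rfl⟩ := hsurj y hy
    rw [hφ a ha, hφ b hb]
    have hab := (hmono.lt_iff_lt (hsub ha) (hsub hb)).1 hxy
    exact hmono (sub_nonneg.2 hb.2) (sub_nonneg.2 ha.2) (by linarith)
  · intro x hx y hy s t hs ht hst
    obtain ⟨c, hc, hce⟩ := hsurj _ (convex_Icc 0 (I m) hx hy hs ht hst)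
    obtain ⟨a, ha, rfl⟩ := hsurj x hx
    obtain ⟨b, hb, rfl⟩ := hsurj y hy
    rw [← hce, hφ a ha, hφ b hb, hφ c hc]
    have hmem : s • a + t • b ∈ Icc 0 m := convex_Icc 0 m ha hb hs ht hst
    have h1 := hconc.2 (hsub ha) (hsub hb) hs ht hst
    rw [← hce] at h1
    have h2 := (hmono.le_iff_le (hsub hc) (hsub hmem)).1 h1
    have ham : m - a ∈ Ici (0:ℝ) := sub_nonneg.2 ha.2
    have hbm : m - b ∈ Ici (0:ℝ) := sub_nonneg.2 hb.2
    refine (hconc.2 ham hbm hs ht hst).trans ?_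
    refine hmono.monotoneOn (convex_Ici 0 ham hbm hs ht hst) (sub_nonneg.2 hc.2) ?_
    simp only [smul_eq_mul] at h2 ⊢
    have : s * (m - a) + t * (m - b) = (s + t) * m - (s * a + t * b) := by ring
    rw [this, hst]
    linarith
end
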